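/- Let N ≥ 2 be an integer, let t₁, ..., t_N be pairwise distinct complex numbers, and let Λ₁, ..., Λ_N ∈ ℂ. Define for each i the ℂ-linear operator on the polynomial ring ℂ[x₁,...,x_N]: Ĝ_i := ∑_{j≠i} (1/(t_j − t_i)) · [ M((x_i − x_j)²) ∘ ∂_i ∘ ∂_j − M(x_i − x_j) ∘ (Λ_i ∂_j − Λ_j ∂_i) − (1/2)Λ_iΛ_j · id ], where ∂_k is partial differentiation with respect to x_k and M(g) is the operator of multiplication by the polynomial g. Then these quantum Gaudin operators pairwise commute: Ĝ_i ∘ Ĝ_j = Ĝ_j ∘ Ĝ_i for all i, j ∈ {1,...,N}. -/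

import Mathlib

open MvPolynomial

/-- The operator of partial differentiation ∂_k on ℂ[x₁,...,x_N]. -/
noncomputable def partialD {N : ℕ} (k : Fin N) :
    Module.End ℂ (MvPolynomial (Fin N) ℂ) :=
  (pderiv k : Derivation ℂ (MvPolynomial (Fin N) ℂ) (MvPolynomial (Fin N) ℂ)).toLinearMap

/-- The operator M(g) of multiplication by the polynomial g on ℂ[x₁,...,x_N]. -/
noncomputable def mulOp {N : ℕ} (g : MvPolynomial (Fin N) ℂ) :
    Module.End ℂ (MvPolynomial (Fin N) ℂ) :=
  LinearMap.mulLeft ℂ g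

/-- The quantum Gaudin operator
Ĝ_i = ∑_{j≠i} (1/(t_j − t_i)) ·
  [ M((x_i − x_j)²) ∘ ∂_i ∘ ∂_j − M(x_i − x_j) ∘ (Λ_i ∂_j − Λ_j ∂_i) − (1/2)Λ_iΛ_j · id ]. -/
noncomputable def gaudinOp {N : ℕ} (t Λ : Fin N → ℂ) (i : Fin N) :
    Module.End ℂ (MvPolynomial (Fin N) ℂ) :=
  ∑ j ∈ Finset.univ.erase i,
    ((t j - t i)⁻¹) •
      (mulOp ((X i - X j) ^ 2) ∘ₗ partialD i ∘ₗ partialD j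
        - mulOp (X i - X j) ∘ₗ (Λ i • partialD j - Λ j • partialD i)
        - ((1 / 2 : ℂ) * Λ i * Λ j) • (1 : Module.End ℂ (MvPolynomial (Fin N) ℂ)))

attribute [local instance] LieRing.ofAssociativeRing

section InfinitesimalBraid

variable {A ι : Type*} [Ring A]

theorem mul_lie_eq_mul_lie_add_lie_mul (a b c : A) : ⁅a * b, c⁆ = a * ⁅b, c⁆ + ⁅a, c⁆ * b := by
  simp only [LieRing.of_associative_ring_bracket]; noncomm_ring

theorem lie_mul_eq_lie_mul_add_mul_lie (a b c : A) : ⁅c, a * b⁆ = ⁅c, a⁆ * b + a * ⁅c, b⁆ := by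
  simp only [LieRing.of_associative_ring_bracket]; noncomm_ring

variable [Algebra ℂ A]

/-- The families `e`, `f`, `h` form mutually commuting `sl₂`-triples `(e i, f i, h i)`. -/
structure CommutingSl2Triples (e f h : ι → A) : Prop where
  lie_e_f : ∀ i, ⁅e i, f i⁆ = h i
  lie_h_e : ∀ i, ⁅h i, e i⁆ = (2 : ℂ) • e i
  lie_h_f : ∀ i, ⁅h i, f i⁆ = -((2 : ℂ) • f i)
  ee : ∀ i j, i ≠ j → ⁅e i, e j⁆ = 0
  ef : ∀ i j, i ≠ j → ⁅e i, f j⁆ = 0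
  eh : ∀ i j, i ≠ j → ⁅e i, h j⁆ = 0
  ff : ∀ i j, i ≠ j → ⁅f i, f j⁆ = 0
  fh : ∀ i j, i ≠ j → ⁅f i, h j⁆ = 0
  hh : ∀ i j, i ≠ j → ⁅h i, h j⁆ = 0

/-- The Casimir tensor of `sl₂` acting in the positions `i` and `j`. -/
noncomputable def casimirTensor (e f h : ι → A) (i j : ι) : A :=
  e i * f j + f i * e j + (1 / 2 : ℂ) • (h i * h j)

namespace CommutingSl2Triples

variable {e f h : ι → A}

theorem lie_f_e (T : CommutingSl2Triples e f h) (i : ι) : ⁅f i, e i⁆ = -h i := by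
  rw [← lie_skew, T.lie_e_f]

theorem lie_e_h (T : CommutingSl2Triples e f h) (i : ι) : ⁅e i, h i⁆ = -((2 : ℂ) • e i) := by
  rw [← lie_skew, T.lie_h_e]

theorem lie_f_h (T : CommutingSl2Triples e f h) (i : ι) : ⁅f i, h i⁆ = (2 : ℂ) • f i := by
  rw [← lie_skew, T.lie_h_f, neg_neg]

theorem fe (T : CommutingSl2Triples e f h) (i j : ι) (hij : i ≠ j) : ⁅f i, e j⁆ = 0 := by
  rw [← lie_skew, T.ef j i hij.symm, neg_zero]

theorem he (T : CommutingSl2Triples e f h) (i j : ι) (hij : i ≠ j) : ⁅h i, e j⁆ = 0 := by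
  rw [← lie_skew, T.eh j i hij.symm, neg_zero]

theorem hf (T : CommutingSl2Triples e f h) (i j : ι) (hij : i ≠ j) : ⁅h i, f j⁆ = 0 := by
  rw [← lie_skew, T.fh j i hij.symm, neg_zero]

theorem casimirTensor_symm (T : CommutingSl2Triples e f h) {i j : ι} (hij : i ≠ j) :
    casimirTensor e f h i j = casimirTensor e f h j i := by
  have h₁ := T.ef i j hij
  have h₂ := T.fe i j hij
  have h₃ := T.hh i j hij
  rw [LieRing.of_associative_ring_bracket, sub_eq_zero] at h₁ h₂ h₃
  rw [casimirTensor, casimirTensor, h₁, h₂, h₃, add_comm (f j * e i)]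

theorem casimirTensor_lie_of_ne (T : CommutingSl2Triples e f h) {i j k : ι} (hik : i ≠ k)
    (hjk : j ≠ k) :
    ⁅casimirTensor e f h i j, e k⁆ = 0 ∧ ⁅casimirTensor e f h i j, f k⁆ = 0 ∧
      ⁅casimirTensor e f h i j, h k⁆ = 0 := by
  simp [casimirTensor, mul_lie_eq_mul_lie_add_lie_mul, T.ee _ _ hik, T.ee _ _ hjk, T.ef _ _ hik,
    T.ef _ _ hjk, T.eh _ _ hik, T.eh _ _ hjk, T.fe _ _ hik, T.fe _ _ hjk, T.ff _ _ hik,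
    T.ff _ _ hjk, T.fh _ _ hik, T.fh _ _ hjk, T.he _ _ hik, T.he _ _ hjk, T.hf _ _ hik,
    T.hf _ _ hjk, T.hh _ _ hik, T.hh _ _ hjk]

theorem casimirTensor_lie_diagonal (T : CommutingSl2Triples e f h) {i j : ι} (hij : i ≠ j) :
    ⁅casimirTensor e f h i j, e i⁆ + ⁅casimirTensor e f h i j, e j⁆ = 0 ∧
    ⁅casimirTensor e f h i j, f i⁆ + ⁅casimirTensor e f h i j, f j⁆ = 0 ∧
    ⁅casimirTensor e f h i j, h i⁆ + ⁅casimirTensor e f h i j, h j⁆ = 0 := by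
  refine ⟨?_, ?_, ?_⟩ <;>
  simp only [casimirTensor, mul_lie_eq_mul_lie_add_lie_mul, add_lie, smul_lie, lie_self,
    T.lie_e_f, T.lie_h_e, T.lie_h_f, T.lie_f_e, T.lie_e_h, T.lie_f_h,
    T.ee _ _ hij, T.ef _ _ hij, T.eh _ _ hij, T.fe _ _ hij, T.ff _ _ hij, T.fh _ _ hij,
    T.he _ _ hij, T.hf _ _ hij, T.hh _ _ hij, T.ee _ _ hij.symm, T.ef _ _ hij.symm,
    T.eh _ _ hij.symm, T.fe _ _ hij.symm, T.ff _ _ hij.symm, T.fh _ _ hij.symm,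
    T.he _ _ hij.symm, T.hf _ _ hij.symm, T.hh _ _ hij.symm,
    mul_zero, zero_mul, smul_mul_assoc, mul_smul_comm, mul_neg, neg_mul] <;>
  module

theorem lie_casimirTensor_of_disjoint (T : CommutingSl2Triples e f h) {i j k l : ι} (hik : i ≠ k)
    (hjk : j ≠ k) (hil : i ≠ l) (hjl : j ≠ l) : ⁅casimirTensor e f h i j, casimirTensor e f h k l⁆ = 0 := by
  obtain ⟨h₁, h₂, h₃⟩ := T.casimirTensor_lie_of_ne hik hjk
  obtain ⟨h₄, h₅, h₆⟩ := T.casimirTensor_lie_of_ne hil hjl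
  rw [casimirTensor.eq_1 e f h k l]
  simp [lie_mul_eq_lie_mul_add_mul_lie, h₁, h₂, h₃, h₄, h₅, h₆]

theorem lie_casimirTensor_add (T : CommutingSl2Triples e f h) {i j k : ι} (hij : i ≠ j)
    (hik : i ≠ k) (hjk : j ≠ k) :
    ⁅casimirTensor e f h i j, casimirTensor e f h i k⁆ +
      ⁅casimirTensor e f h i j, casimirTensor e f h j k⁆ = 0 := by
  obtain ⟨h₁, h₂, h₃⟩ := T.casimirTensor_lie_of_ne hik hjk
  obtain ⟨h₄, h₅, h₆⟩ := T.casimirTensor_lie_diagonal hij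
  rw [casimirTensor.eq_1 e f h i k, casimirTensor.eq_1 e f h j k]
  simp only [lie_add, lie_smul, lie_mul_eq_lie_mul_add_mul_lie, h₁, h₂, h₃, mul_zero, add_zero,
    eq_neg_of_add_eq_zero_left h₄, eq_neg_of_add_eq_zero_left h₅, eq_neg_of_add_eq_zero_left h₆,
    neg_mul]
  module

end CommutingSl2Triples

/-- Gaudin Hamiltonians built from a family satisfying the infinitesimal braid relations commute. -/
theorem lie_sum_inv_smul_eq_zero [Fintype ι] [DecidableEq ι] {t : ι → ℂ}
    (ht : Function.Injective t) {B : ι → ι → A} (hsymm : ∀ i j, i ≠ j → B i j = B j i)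
    (hdisj : ∀ i j k l, i ≠ k → j ≠ k → i ≠ l → j ≠ l → ⁅B i j, B k l⁆ = 0)
    (hadd : ∀ i j k, i ≠ j → i ≠ k → j ≠ k → ⁅B i j, B i k⁆ + ⁅B i j, B j k⁆ = 0) (i j : ι) :
    ⁅∑ k ∈ Finset.univ.erase i, (t k - t i)⁻¹ • B i k,
      ∑ k ∈ Finset.univ.erase j, (t k - t j)⁻¹ • B j k⁆ = 0 := by
  obtain rfl | hij := eq_or_ne i j
  · exact lie_self _
  have hi : Finset.univ.erase i = insert j ((Finset.univ.erase i).erase j) :=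
    (Finset.insert_erase (by simp [hij.symm])).symm
  have hj : Finset.univ.erase j = insert i ((Finset.univ.erase i).erase j) := by
    rw [Finset.erase_right_comm, Finset.insert_erase (by simp [hij])]
  rw [hi, hj, Finset.sum_insert (by simp), Finset.sum_insert (by simp), hsymm j i hij.symm]
  set S := (Finset.univ.erase i).erase j
  have hS : ∀ k ∈ S, i ≠ k ∧ j ≠ k := by
    intro k hk
    simp only [S, Finset.mem_erase] at hk
    exact ⟨hk.2.1.symm, hk.1.symm⟩
  have hdiag : ⁅∑ k ∈ S, (t k - t i)⁻¹ • B i k, ∑ k ∈ S, (t k - t j)⁻¹ • B j k⁆ =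
      ∑ k ∈ S, ((t k - t i)⁻¹ * (t k - t j)⁻¹) • ⁅B i k, B j k⁆ := by
    rw [sum_lie]
    refine Finset.sum_congr rfl fun k hk => ?_
    rw [lie_sum, Finset.sum_eq_single_of_mem k hk, smul_lie, lie_smul, smul_smul]
    intro l hl hlk
    rw [smul_lie, lie_smul,
      hdisj i k j l hij (hS k hk).2.symm (hS l hl).1 hlk.symm, smul_zero, smul_zero]
  rw [add_lie, lie_add, lie_add, hdiag, smul_lie, lie_smul, lie_self, smul_zero, smul_zero,
    zero_add, lie_sum, sum_lie,
    ← Finset.sum_add_distrib, ← Finset.sum_add_distrib]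
  refine Finset.sum_eq_zero fun k hk => ?_
  obtain ⟨hik, hjk⟩ := hS k hk
  have h₁ : ⁅B i k, B i j⁆ = ⁅B i j, B j k⁆ := by
    rw [← lie_skew, eq_neg_of_add_eq_zero_left (hadd i j k hij hik hjk), neg_neg]
  have h₂ : ⁅B i k, B j k⁆ = -⁅B i j, B j k⁆ := by
    rw [← h₁, hsymm j k hjk]
    exact eq_neg_of_add_eq_zero_right (hsymm k j hjk.symm ▸ hadd i k j hik hij hjk.symm)
  have hc : (t j - t i)⁻¹ * (t k - t j)⁻¹ + ((t k - t i)⁻¹ * (t i - t j)⁻¹ -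
      (t k - t i)⁻¹ * (t k - t j)⁻¹) = 0 := by
    have := sub_ne_zero.2 (ht.ne hij)
    have := sub_ne_zero.2 (ht.ne hij.symm)
    have := sub_ne_zero.2 (ht.ne hik.symm)
    have := sub_ne_zero.2 (ht.ne hjk.symm)
    rw [← neg_sub (t j) (t i), inv_neg]
    field_simp
    ring
  simp only [smul_lie, lie_smul, smul_smul, h₁, h₂]
  match_scalars
  linear_combination hc

end InfinitesimalBraid

theorem pderiv_comm_apply {N : ℕ} (i j : Fin N) (p : MvPolynomial (Fin N) ℂ) :
    pderiv i (pderiv j p) = pderiv j (pderiv i p) := by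
  have : ⁅(pderiv i : Derivation ℂ (MvPolynomial (Fin N) ℂ) (MvPolynomial (Fin N) ℂ)),
      (pderiv j : Derivation ℂ (MvPolynomial (Fin N) ℂ) (MvPolynomial (Fin N) ℂ))⁆ = 0 := by
    refine MvPolynomial.derivation_ext fun k => ?_
    simp [Derivation.commutator_apply, pderiv_X, Pi.single_apply, apply_ite]
  simpa [Derivation.commutator_apply, sub_eq_zero] using DFunLike.congr_fun this p

/-- The operator `-x_i² ∂_i + Λ_i x_i`, opposite to `∂_i` in an `sl₂`-triple. -/
noncomputable def oppositeOp {N : ℕ} (Λ : Fin N → ℂ) (i : Fin N) :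
    Module.End ℂ (MvPolynomial (Fin N) ℂ) :=
  Λ i • mulOp (X i) - mulOp (X i ^ 2) * partialD i

/-- The Cartan operator `-2 x_i ∂_i + Λ_i`. -/
noncomputable def cartanOp {N : ℕ} (Λ : Fin N → ℂ) (i : Fin N) :
    Module.End ℂ (MvPolynomial (Fin N) ℂ) :=
  Λ i • (1 : Module.End ℂ (MvPolynomial (Fin N) ℂ)) - (2 : ℂ) • (mulOp (X i) * partialD i)

theorem commutingSl2Triples_partialD {N : ℕ} (Λ : Fin N → ℂ) :
    CommutingSl2Triples partialD (oppositeOp Λ) (cartanOp Λ) := by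
  have hC : (C 2 : MvPolynomial (Fin N) ℂ) = 2 := map_ofNat C 2
  have hD (k : Fin N) : pderiv k (2 : MvPolynomial (Fin N) ℂ) = 0 := by rw [← hC, pderiv_C]
  constructor
  case lie_e_f | lie_h_e | lie_h_f =>
    intro i
    refine LinearMap.ext fun p => ?_
    simp [LieRing.of_associative_ring_bracket, oppositeOp, cartanOp, partialD, mulOp,
      Derivation.leibniz, smul_eq_C_mul, hC, hD]
    try ring
  all_goals
    intro i j hij
    refine LinearMap.ext fun p => ?_
    simp [LieRing.of_associative_ring_bracket, oppositeOp, cartanOp, partialD, mulOp,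
      Derivation.leibniz, pderiv_X_of_ne hij, pderiv_X_of_ne hij.symm, pderiv_comm_apply j i,
      smul_eq_C_mul, hC, hD]
    try ring

theorem gaudinOp_eq_sum_casimirTensor {N : ℕ} (t Λ : Fin N → ℂ) (i : Fin N) :
    gaudinOp t Λ i = ∑ j ∈ Finset.univ.erase i, (-t j - -t i)⁻¹ •
      casimirTensor partialD (oppositeOp Λ) (cartanOp Λ) i j := by
  refine Finset.sum_congr rfl fun j hj => ?_
  have hji : j ≠ i := Finset.ne_of_mem_erase hj
  have hC : (C 2 : MvPolynomial (Fin N) ℂ) = 2 := map_ofNat C 2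
  have hD : pderiv i (2 : MvPolynomial (Fin N) ℂ) = 0 := by rw [← hC, pderiv_C]
  have hC' : (C 2⁻¹ : MvPolynomial (Fin N) ℂ) * 2 = 1 := by
    rw [← hC, ← C_mul]; norm_num
  refine LinearMap.ext fun p => ?_
  rw [show -t j - -t i = -(t j - t i) by ring, inv_neg]
  simp [casimirTensor, oppositeOp, cartanOp, partialD, mulOp, Derivation.leibniz,
    pderiv_X_of_ne hji, smul_eq_C_mul, hC, hD]
  linear_combination C (t j - t i)⁻¹ * (2 * X i * X j * pderiv i (pderiv j p)
    - X i * C (Λ j) * pderiv i p - X j * C (Λ i) * pderiv j p) * hC'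

theorem gaudin_operators_commute (N : ℕ) (hN : 2 ≤ N) (t : Fin N → ℂ)
    (ht : Function.Injective t) (Λ : Fin N → ℂ) (i j : Fin N) :
    gaudinOp t Λ i ∘ₗ gaudinOp t Λ j = gaudinOp t Λ j ∘ₗ gaudinOp t Λ i := by
  have T := commutingSl2Triples_partialD Λ
  have key := lie_sum_inv_smul_eq_zero (neg_injective.comp ht) (fun _ _ => T.casimirTensor_symm)
    (fun _ _ _ _ => T.lie_casimirTensor_of_disjoint) (fun _ _ _ => T.lie_casimirTensor_add) i j
  simp only [Function.comp_apply, ← gaudinOp_eq_sum_casimirTensor] at key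
  exact sub_eq_zero.1 key
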